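/- Let N ≥ 2, m > 1, ℓ ≥ 0 and k ≥ 0 be integers with (ℓ,k) ≠ (0,0), and let p : ℝ^N → ℝ be a polynomial function that is homogeneous of degree ℓ and harmonic (Δp = 0). Define ψ : ℝ^N → ℝ by ψ(x) = F(|x|²)·p(x), where F(z) = Σ_{j=0}^{k} [(-k)_j (1/(m-1) + ℓ + N/2 - 1 + k)_j / ((ℓ + N/2)_j · j!)] · z^j and (s)_j = s(s+1)⋯(s+j-1) denotes the Pochhammer symbol. Then for every x in the open unit ball B_1 ⊂ ℝ^N, (H_E ψ)(x) = λ_{ℓk} ψ(x), where λ_{ℓk} = ℓ + 2k + 2k(k + ℓ + N/2 - 1)(m-1). -/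

import Mathlib

open MeasureTheory Real Filter ENNReal

noncomputable section

/-- The `i`-th partial derivative of `f` at `x`. -/
def pdv (N : ℕ) (f : EuclideanSpace ℝ (Fin N) → ℝ) (i : Fin N)
    (x : EuclideanSpace ℝ (Fin N)) : ℝ :=
  fderiv ℝ f x (EuclideanSpace.single i 1)

/-- The Laplacian of `f` at `x`. -/
def lap (N : ℕ) (f : EuclideanSpace ℝ (Fin N) → ℝ)
    (x : EuclideanSpace ℝ (Fin N)) : ℝ :=
  ∑ i, pdv N (pdv N f i) i x

/-- The porous medium displacement Hessian
`(H_E ψ)(x) = -((m-1)/2)(1-|x|²)Δψ(x) + x·∇ψ(x)`. -/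
def HE (N : ℕ) (m : ℝ) (f : EuclideanSpace ℝ (Fin N) → ℝ)
    (x : EuclideanSpace ℝ (Fin N)) : ℝ :=
  -((m - 1) / 2) * (1 - ‖x‖ ^ 2) * lap N f x + ∑ i, x i * pdv N f i x


open Polynomial in
/-- A polynomial whose coefficients satisfy the hypergeometric recurrence solves the
hypergeometric differential equation. -/
lemma hypergeometric_ode (a b c : ℝ) (G : ℝ[X])
    (hG : ∀ n : ℕ, ((n : ℝ) + 1) * (c + n) * G.coeff (n + 1) = (a + n) * (b + n) * G.coeff n)
    (z : ℝ) :
    z * (1 - z) * G.derivative.derivative.eval z + (c - (a + b + 1) * z) * G.derivative.eval z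
      - a * b * G.eval z = 0 := by
  have key : X * G.derivative.derivative - X * (X * G.derivative.derivative)
      + C c * G.derivative - C (a + b + 1) * (X * G.derivative) - C (a * b) * G = 0 := by
    ext n
    rcases n with _ | _ | n
    · have h := hG 0
      simp [coeff_derivative] at h ⊢
      linarith
    · have h := hG 1
      simp only [coeff_sub, coeff_add, coeff_X_mul, coeff_C_mul, coeff_derivative, coeff_zero,
        mul_coeff_zero, coeff_X_zero]
      push_cast at h ⊢
      linarith
    · have h := hG (n + 2)
      simp only [coeff_sub, coeff_add, coeff_X_mul, coeff_C_mul, coeff_derivative, coeff_zero]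
      push_cast at h ⊢
      linarith
  have := congrArg (eval z) key
  simp only [eval_sub, eval_add, eval_mul, eval_X, eval_C, eval_zero] at this
  linarith

/-- The coefficients of the hypergeometric series `₂F₁(a, b; c; z)`. -/
def hypergeometricCoeff (a b c : ℝ) (j : ℕ) : ℝ :=
  ((ascPochhammer ℝ j).eval a * (ascPochhammer ℝ j).eval b) /
    ((ascPochhammer ℝ j).eval c * (Nat.factorial j : ℝ))

lemma hypergeometricCoeff_succ (a b c : ℝ) (hc : 0 < c) (n : ℕ) :
    ((n : ℝ) + 1) * (c + n) * hypergeometricCoeff a b c (n + 1)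
      = (a + n) * (b + n) * hypergeometricCoeff a b c n := by
  have h1 : (ascPochhammer ℝ n).eval c ≠ 0 := (ascPochhammer_pos n c hc).ne'
  have h2 : (Nat.factorial n : ℝ) ≠ 0 := by positivity
  have h3 : c + n ≠ 0 := by positivity
  have h4 : (n : ℝ) + 1 ≠ 0 := by positivity
  simp only [hypergeometricCoeff, ascPochhammer_succ_eval, Nat.factorial_succ]
  push_cast
  field_simp

lemma hypergeometricCoeff_neg_natCast_of_lt (b c : ℝ) {k j : ℕ} (h : k < j) :
    hypergeometricCoeff (-(k : ℝ)) b c j = 0 := by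
  simp [hypergeometricCoeff, ascPochhammer_eval_neg_coe_nat_of_lt h]

open Polynomial in
/-- The terminating hypergeometric series `₂F₁(-k, b; c; z)` as a polynomial. -/
def hypergeometricPoly (k : ℕ) (b c : ℝ) : ℝ[X] :=
  ∑ j ∈ Finset.range (k + 1), monomial j (hypergeometricCoeff (-(k : ℝ)) b c j)

lemma hypergeometricPoly_coeff (k : ℕ) (b c : ℝ) (n : ℕ) :
    (hypergeometricPoly k b c).coeff n = hypergeometricCoeff (-(k : ℝ)) b c n := by
  simp only [hypergeometricPoly, Polynomial.finsetSum_coeff, Polynomial.coeff_monomial,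
    Finset.sum_ite_eq', Finset.mem_range]
  split_ifs with h
  · rfl
  · exact (hypergeometricCoeff_neg_natCast_of_lt b c (by omega)).symm

lemma contDiff_mvPolynomial_eval {N : ℕ} (P : MvPolynomial (Fin N) ℝ) {n : WithTop ℕ∞} :
    ContDiff ℝ n (fun x : EuclideanSpace ℝ (Fin N) => MvPolynomial.eval (fun i => x i) P) := by
  induction P using MvPolynomial.induction_on with
  | C a => simpa using contDiff_const
  | add p q hp hq => simpa using hp.add hq
  | mul_X p i hp =>
    simp only [map_mul, MvPolynomial.eval_X]
    exact hp.mul (by fun_prop)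

lemma differentiable_pdv {N : ℕ} {f : EuclideanSpace ℝ (Fin N) → ℝ} (hf : ContDiff ℝ 2 f)
    (i : Fin N) : Differentiable ℝ (pdv N f i) :=
  ((hf.fderiv_right (m := 1) (by norm_num)).differentiable (by norm_num)).clm_apply
    (differentiable_const _)

lemma sum_mul_pdv {N : ℕ} (f : EuclideanSpace ℝ (Fin N) → ℝ) (x : EuclideanSpace ℝ (Fin N)) :
    ∑ i, x i * pdv N f i x = fderiv ℝ f x x := by
  have hx : x = ∑ i, x i • EuclideanSpace.single i (1 : ℝ) := by
    ext j
    simp [Finset.sum_apply, Pi.single_apply]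
  conv_rhs => rw [hx, map_sum]
  rw [← hx]
  simp [pdv]

/-- Euler's identity for homogeneous functions. -/
lemma euler_identity {N : ℕ} {p : EuclideanSpace ℝ (Fin N) → ℝ} (hp : Differentiable ℝ p) {ℓ : ℕ}
    (hhom : ∀ (t : ℝ) (x : EuclideanSpace ℝ (Fin N)), p (t • x) = t ^ ℓ * p x)
    (x : EuclideanSpace ℝ (Fin N)) :
    ∑ i, x i * pdv N p i x = ℓ * p x := by
  rw [sum_mul_pdv]
  have h1 : HasDerivAt (fun t : ℝ => t • x) x 1 := by
    simpa using (hasDerivAt_id (1 : ℝ)).smul_const x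
  have h2 : HasFDerivAt p (fderiv ℝ p x) ((1 : ℝ) • x) := by
    rw [one_smul]
    exact (hp x).hasFDerivAt
  have h3 : HasDerivAt (fun t : ℝ => p (t • x)) (fderiv ℝ p x x) 1 := h2.comp_hasDerivAt 1 h1
  have h4 : HasDerivAt (fun t : ℝ => t ^ ℓ * p x) (ℓ * p x) 1 := by
    simpa using (hasDerivAt_pow ℓ (1 : ℝ)).mul_const (p x)
  simp only [hhom] at h3
  exact h3.unique h4

lemma pdv_mul {N : ℕ} {f g : EuclideanSpace ℝ (Fin N) → ℝ} (hf : Differentiable ℝ f)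
    (hg : Differentiable ℝ g) (i : Fin N) (x : EuclideanSpace ℝ (Fin N)) :
    pdv N (fun y => f y * g y) i x = pdv N f i x * g x + f x * pdv N g i x := by
  simp only [pdv]
  rw [fderiv_fun_mul (hf x) (hg x)]
  simp
  ring

lemma pdv_add {N : ℕ} {f g : EuclideanSpace ℝ (Fin N) → ℝ} (hf : Differentiable ℝ f)
    (hg : Differentiable ℝ g) (i : Fin N) (x : EuclideanSpace ℝ (Fin N)) :
    pdv N (fun y => f y + g y) i x = pdv N f i x + pdv N g i x := by
  simp only [pdv]
  rw [fderiv_fun_add (hf x) (hg x)]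
  simp

lemma pdv_coord {N : ℕ} (i : Fin N) (x : EuclideanSpace ℝ (Fin N)) :
    pdv N (fun y => y i) i x = 1 := by
  have h : HasFDerivAt (fun y : EuclideanSpace ℝ (Fin N) => y i)
      (EuclideanSpace.proj i : EuclideanSpace ℝ (Fin N) →L[ℝ] ℝ) x :=
    (EuclideanSpace.proj i : EuclideanSpace ℝ (Fin N) →L[ℝ] ℝ).hasFDerivAt
  simp [pdv, h.fderiv]

open Polynomial in
lemma differentiable_eval_norm_sq {N : ℕ} (G : ℝ[X]) :
    Differentiable ℝ (fun y : EuclideanSpace ℝ (Fin N) => G.eval (‖y‖ ^ 2)) :=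
  G.differentiable.comp (differentiable_id.norm_sq ℝ)

open Polynomial in
lemma pdv_eval_norm_sq {N : ℕ} (G : ℝ[X]) (i : Fin N) (x : EuclideanSpace ℝ (Fin N)) :
    pdv N (fun y => G.eval (‖y‖ ^ 2)) i x = G.derivative.eval (‖x‖ ^ 2) * (2 * x i) := by
  have h := (G.hasDerivAt (‖x‖ ^ 2)).comp_hasFDerivAt x
    (hasStrictFDerivAt_norm_sq x).hasFDerivAt
  change fderiv ℝ ((fun z => G.eval z) ∘ fun y => ‖y‖ ^ 2) x _ = _
  rw [h.fderiv]
  simp [EuclideanSpace.inner_single_right]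

open Polynomial in
lemma pdv_radial_mul {N : ℕ} (G : ℝ[X]) {p : EuclideanSpace ℝ (Fin N) → ℝ}
    (hp : Differentiable ℝ p) (i : Fin N) (x : EuclideanSpace ℝ (Fin N)) :
    pdv N (fun y => G.eval (‖y‖ ^ 2) * p y) i x
      = G.derivative.eval (‖x‖ ^ 2) * (2 * x i) * p x + G.eval (‖x‖ ^ 2) * pdv N p i x := by
  rw [pdv_mul (differentiable_eval_norm_sq G) hp, pdv_eval_norm_sq]

open Polynomial in
lemma pdv_pdv_radial_mul {N : ℕ} (G : ℝ[X]) {p : EuclideanSpace ℝ (Fin N) → ℝ}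
    (hp : ContDiff ℝ 2 p) (i : Fin N) (x : EuclideanSpace ℝ (Fin N)) :
    pdv N (pdv N (fun y => G.eval (‖y‖ ^ 2) * p y) i) i x
      = 4 * G.derivative.derivative.eval (‖x‖ ^ 2) * p x * x i ^ 2
        + 2 * G.derivative.eval (‖x‖ ^ 2) * p x
        + 4 * G.derivative.eval (‖x‖ ^ 2) * (x i * pdv N p i x)
        + G.eval (‖x‖ ^ 2) * pdv N (pdv N p i) i x := by
  have hp1 : Differentiable ℝ p := hp.differentiable (by norm_num)
  have hp2 := differentiable_pdv hp i
  have hx : Differentiable ℝ (fun y : EuclideanSpace ℝ (Fin N) => y i) := by fun_prop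
  have hG := differentiable_eval_norm_sq (N := N) G
  have hG' := differentiable_eval_norm_sq (N := N) (C 2 * G.derivative)
  have hfun : pdv N (fun y => G.eval (‖y‖ ^ 2) * p y) i = fun y =>
      (C 2 * G.derivative).eval (‖y‖ ^ 2) * (y i * p y) + G.eval (‖y‖ ^ 2) * pdv N p i y := by
    funext y
    rw [pdv_radial_mul G hp1]
    simp only [eval_mul, eval_C]
    ring
  rw [hfun, pdv_add (hG'.fun_mul (hx.fun_mul hp1)) (hG.fun_mul hp2),
    pdv_radial_mul _ (hx.fun_mul hp1), pdv_radial_mul _ hp2, pdv_mul hx hp1, pdv_coord]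
  simp only [derivative_mul, derivative_C, eval_add, eval_mul, eval_C, zero_mul, eval_zero]
  ring

open Polynomial in
lemma lap_radial_mul {N : ℕ} (G : ℝ[X]) {p : EuclideanSpace ℝ (Fin N) → ℝ}
    (hp : ContDiff ℝ 2 p) (x : EuclideanSpace ℝ (Fin N)) :
    lap N (fun y => G.eval (‖y‖ ^ 2) * p y) x
      = 4 * G.derivative.derivative.eval (‖x‖ ^ 2) * p x * ‖x‖ ^ 2
        + N * (2 * G.derivative.eval (‖x‖ ^ 2) * p x)
        + 4 * G.derivative.eval (‖x‖ ^ 2) * ∑ i, x i * pdv N p i x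
        + G.eval (‖x‖ ^ 2) * lap N p x := by
  simp only [lap, pdv_pdv_radial_mul G hp, Finset.sum_add_distrib, ← Finset.mul_sum,
    ← EuclideanSpace.real_norm_sq_eq, Finset.sum_const, Finset.card_univ, Fintype.card_fin,
    nsmul_eq_mul]
  ring

open Polynomial in
lemma sum_mul_pdv_radial_mul {N : ℕ} (G : ℝ[X]) {p : EuclideanSpace ℝ (Fin N) → ℝ}
    (hp : Differentiable ℝ p) (x : EuclideanSpace ℝ (Fin N)) :
    ∑ i, x i * pdv N (fun y => G.eval (‖y‖ ^ 2) * p y) i x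
      = 2 * G.derivative.eval (‖x‖ ^ 2) * p x * ‖x‖ ^ 2
        + G.eval (‖x‖ ^ 2) * ∑ i, x i * pdv N p i x := by
  rw [EuclideanSpace.real_norm_sq_eq x, Finset.mul_sum, Finset.mul_sum,
    ← Finset.sum_add_distrib, ← EuclideanSpace.real_norm_sq_eq x]
  refine Finset.sum_congr rfl fun i _ => ?_
  rw [pdv_radial_mul G hp]
  ring

/-- For `N ≥ 2`, `m > 1`, `(ℓ,k) ≠ (0,0)` and a harmonic polynomial `p`,
homogeneous of degree `ℓ`, the function `ψ(x) = F(|x|²) p(x)` with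
`F(z) = Σ_{j=0}^{k} [(-k)_j (1/(m-1) + ℓ + N/2 - 1 + k)_j / ((ℓ + N/2)_j j!)] z^j`
is an eigenfunction of `H_E` on the unit ball with eigenvalue
`λ_{ℓk} = ℓ + 2k + 2k(k + ℓ + N/2 - 1)(m-1)`. -/
theorem stmt1 (N : ℕ) (hN : 2 ≤ N) (m : ℝ) (hm : 1 < m) (ℓ k : ℕ)
    (hℓk : (ℓ, k) ≠ (0, 0))
    (p : EuclideanSpace ℝ (Fin N) → ℝ)
    (hpoly : ∃ P : MvPolynomial (Fin N) ℝ, ∀ x, p x = MvPolynomial.eval (fun i => x i) P)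
    (hhom : ∀ (t : ℝ) (x : EuclideanSpace ℝ (Fin N)), p (t • x) = t ^ ℓ * p x)
    (hharm : ∀ x, lap N p x = 0)
    (F : ℝ → ℝ)
    (hF : F = fun z => ∑ j ∈ Finset.range (k + 1),
      ((ascPochhammer ℝ j).eval (-(k : ℝ)) *
          (ascPochhammer ℝ j).eval (1 / (m - 1) + (ℓ : ℝ) + (N : ℝ) / 2 - 1 + (k : ℝ))) /
        ((ascPochhammer ℝ j).eval ((ℓ : ℝ) + (N : ℝ) / 2) * (Nat.factorial j : ℝ)) * z ^ j)
    (ψ : EuclideanSpace ℝ (Fin N) → ℝ) (hψ : ψ = fun x => F (‖x‖ ^ 2) * p x)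
    (lam : ℝ)
    (hlam : lam = (ℓ : ℝ) + 2 * (k : ℝ)
      + 2 * (k : ℝ) * ((k : ℝ) + (ℓ : ℝ) + (N : ℝ) / 2 - 1) * (m - 1)) :
    ∀ x : EuclideanSpace ℝ (Fin N), ‖x‖ < 1 → HE N m ψ x = lam * ψ x := by
  intro x _
  obtain ⟨P, hP⟩ := hpoly
  have hp : ContDiff ℝ 2 p := by
    rw [funext hP]
    exact contDiff_mvPolynomial_eval P
  have hp1 : Differentiable ℝ p := hp.differentiable (by norm_num)
  have hm' : m - 1 ≠ 0 := by linarith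
  have hN' : (0 : ℝ) < N := by exact_mod_cast (by omega : 0 < N)
  have hc : 0 < (ℓ : ℝ) + (N : ℝ) / 2 := by positivity
  set b : ℝ := 1 / (m - 1) + (ℓ : ℝ) + (N : ℝ) / 2 - 1 + (k : ℝ) with hb
  set c : ℝ := (ℓ : ℝ) + (N : ℝ) / 2 with hc_def
  set G := hypergeometricPoly k b c with hG
  have hψG : ψ = fun y => G.eval (‖y‖ ^ 2) * p y := by
    simp [hψ, hF, hG, hypergeometricPoly, Polynomial.eval_finsetSum, hypergeometricCoeff]
  have hode := hypergeometric_ode (-(k : ℝ)) b c G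
    (fun n => by simpa only [hG, hypergeometricPoly_coeff] using hypergeometricCoeff_succ _ b c hc n)
    (‖x‖ ^ 2)
  have hmb : (m - 1) * b = 1 + (m - 1) * (c - 1 + k) := by
    rw [hb, hc_def]
    field_simp
    ring
  rw [hψG, HE, lap_radial_mul G hp, sum_mul_pdv_radial_mul G hp1, euler_identity hp1 hhom, hharm,
    hlam]
  have hN2 : (N : ℝ) = 2 * (c - ℓ) := by rw [hc_def]; ring
  rw [hN2]
  beta_reduce
  generalize G.eval (‖x‖ ^ 2) = g at *
  generalize G.derivative.eval (‖x‖ ^ 2) = g' at *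
  generalize G.derivative.derivative.eval (‖x‖ ^ 2) = g'' at *
  generalize ‖x‖ ^ 2 = z at *
  clear_value b c
  linear_combination (-2 * (m - 1) * p x) * hode + (2 * k * g * p x - 2 * z * g' * p x) * hmb
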